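/- For every c₀ ∈ ℂ∖{0}, the assignment k(x_1) = qx_1, k(x_2) = qx_2, k(x_3) = q⁻²x_3, e(x_1) = 0, e(x_2) = 0, e(x_3) = c₀·1, f(x_1) = c₀⁻¹x_1x_3, f(x_2) = c₀⁻¹x_2x_3, f(x_3) = −qc₀⁻¹x_3², extended by the module-algebra conditions, defines a module-algebra structure of U_q(sl(2)) on the quantum 3-space A_q(3). -/

import Mathlib

noncomputable section

open scoped BigOperators

/-- The defining relations of the quantum `n`-space `A_q(n)`:
`x_i x_j = q • (x_j x_i)` for `i > j`. -/
inductive QRel (q : ℂ) (n : ℕ) : FreeAlgebra ℂ (Fin n) → FreeAlgebra ℂ (Fin n) → Prop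
  | rel (i j : Fin n) (h : j < i) :
      QRel q n (FreeAlgebra.ι ℂ i * FreeAlgebra.ι ℂ j)
        (q • (FreeAlgebra.ι ℂ j * FreeAlgebra.ι ℂ i))

/-- The quantum `n`-space `A_q(n)`. -/
abbrev QSpace (q : ℂ) (n : ℕ) : Type := RingQuot (QRel q n)

/-- The generator `x_i` of the quantum `n`-space. -/
def Xg (q : ℂ) (n : ℕ) (i : Fin n) : QSpace q n :=
  RingQuot.mkAlgHom ℂ (QRel q n) (FreeAlgebra.ι ℂ i)

/-- The Cartan matrix of `sl(m+1)`: `a_{ii} = 2`, `a_{ij} = -1` if `|i-j| = 1`,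
`a_{ij} = 0` if `|i-j| > 1`. -/
def cartan (m : ℕ) (i j : Fin m) : ℤ :=
  if i = j then 2 else if ((i : ℤ) - (j : ℤ)).natAbs = 1 then -1 else 0

/-- A module-algebra structure of `U_q(sl(m+1))` on a unital `ℂ`-algebra `A`:
`ℂ`-linear maps `k_i` (unital algebra automorphisms with two-sided inverses `(k i).symm`),
`e_i`, `f_i` for `1 ≤ i ≤ m`, satisfying the twisted Leibniz rules and the defining
operator relations of `U_q(sl(m+1))`. -/
structure UqslMA (q : ℂ) (m : ℕ) (A : Type) [Ring A] [Algebra ℂ A] where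
  k : Fin m → (A ≃ₐ[ℂ] A)
  e : Fin m → (A →ₗ[ℂ] A)
  f : Fin m → (A →ₗ[ℂ] A)
  e_mul : ∀ (i : Fin m) (a b : A), e i (a * b) = a * e i b + e i a * k i b
  f_mul : ∀ (i : Fin m) (a b : A), f i (a * b) = (k i).symm a * f i b + f i a * b
  e_one : ∀ i : Fin m, e i 1 = 0
  f_one : ∀ i : Fin m, f i 1 = 0
  k_comm : ∀ (i j : Fin m) (a : A), k i (k j a) = k j (k i a)
  ke : ∀ (i j : Fin m) (a : A), k i (e j ((k i).symm a)) = q ^ cartan m i j • e j a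
  kf : ∀ (i j : Fin m) (a : A), k i (f j ((k i).symm a)) = q ^ (-cartan m i j) • f j a
  ef : ∀ (i j : Fin m) (a : A),
      e i (f j a) - f j (e i a) =
        if i = j then (q - q⁻¹)⁻¹ • (k i a - (k i).symm a) else 0
  ee_comm : ∀ i j : Fin m, cartan m i j = 0 → ∀ a : A, e i (e j a) = e j (e i a)
  ff_comm : ∀ i j : Fin m, cartan m i j = 0 → ∀ a : A, f i (f j a) = f j (f i a)
  serre_e : ∀ i j : Fin m, cartan m i j = -1 → ∀ a : A,
      e i (e i (e j a)) - (q + q⁻¹) • e i (e j (e i a)) + e j (e i (e i a)) = 0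
  serre_f : ∀ i j : Fin m, cartan m i j = -1 → ∀ a : A,
      f i (f i (f j a)) - (q + q⁻¹) • f i (f j (f i a)) + f j (f i (f i a)) = 0

/-- Isomorphism of module-algebra structures: an algebra automorphism `ψ` of `A` with
`ψ ∘ π₁(h) ∘ ψ⁻¹ = π₂(h)` for every generator `h ∈ {k_i^{±1}, e_i, f_i}`. -/
def UqslMA.Iso {q : ℂ} {m : ℕ} {A : Type} [Ring A] [Algebra ℂ A]
    (π₁ π₂ : UqslMA q m A) : Prop :=
  ∃ ψ : A ≃ₐ[ℂ] A,
    (∀ (i : Fin m) (a : A), ψ (π₁.k i (ψ.symm a)) = π₂.k i a) ∧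
    (∀ (i : Fin m) (a : A), ψ ((π₁.k i).symm (ψ.symm a)) = (π₂.k i).symm a) ∧
    (∀ (i : Fin m) (a : A), ψ (π₁.e i (ψ.symm a)) = π₂.e i a) ∧
    (∀ (i : Fin m) (a : A), ψ (π₁.f i (ψ.symm a)) = π₂.f i a)

/-- The generator `x_1` of the quantum 3-space. -/
def Z1 (q : ℂ) : QSpace q 3 := Xg q 3 0
/-- The generator `x_2` of the quantum 3-space. -/
def Z2 (q : ℂ) : QSpace q 3 := Xg q 3 1
/-- The generator `x_3` of the quantum 3-space. -/
def Z3 (q : ℂ) : QSpace q 3 := Xg q 3 2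

namespace QSpace

variable {q : ℂ} {n : ℕ}

lemma Xg_mul_Xg {i j : Fin n} (h : j < i) :
    Xg q n i * Xg q n j = q • (Xg q n j * Xg q n i) := by
  simpa [Xg] using RingQuot.mkAlgHom_rel ℂ (QRel.rel (q := q) i j h)

/-- The algebra map out of the quantum space determined by `q`-commuting images of generators. -/
def lift {B : Type} [Ring B] [Algebra ℂ B] (g : Fin n → B)
    (hg : ∀ i j, j < i → g i * g j = q • (g j * g i)) : QSpace q n →ₐ[ℂ] B :=
  RingQuot.liftAlgHom ℂ ⟨FreeAlgebra.lift ℂ g, fun _ _ h => by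
    obtain ⟨i, j, h⟩ := h
    simpa using hg i j h⟩

@[simp]
lemma lift_Xg {B : Type} [Ring B] [Algebra ℂ B] (g : Fin n → B)
    (hg : ∀ i j, j < i → g i * g j = q • (g j * g i)) (i : Fin n) :
    lift g hg (Xg q n i) = g i := by
  simp [lift, Xg]

@[elab_as_elim]
lemma induction {P : QSpace q n → Prop} (a : QSpace q n)
    (algebraMap : ∀ r, P (algebraMap ℂ (QSpace q n) r)) (gen : ∀ i, P (Xg q n i))
    (mul : ∀ a b, P a → P b → P (a * b)) (add : ∀ a b, P a → P b → P (a + b)) : P a := by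
  obtain ⟨a, rfl⟩ := RingQuot.mkAlgHom_surjective ℂ (QRel q n) a
  induction a using FreeAlgebra.induction with
  | grade0 r => simpa using algebraMap r
  | grade1 i => exact gen i
  | mul a b ha hb => simpa using mul _ _ ha hb
  | add a b ha hb => simpa using add _ _ ha hb

/-- The endomorphism rescaling each generator. -/
def scaleHom (q : ℂ) (d : Fin n → ℂ) : QSpace q n →ₐ[ℂ] QSpace q n :=
  lift (fun i => d i • Xg q n i) fun i j h => by
    simp only [smul_mul_smul_comm, Xg_mul_Xg h, smul_smul]
    congr 1
    ring

lemma scaleHom_comp (d d' : Fin n → ℂ) (h : ∀ i, d i * d' i = 1) (a : QSpace q n) :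
    scaleHom q d (scaleHom q d' a) = a := by
  induction a using induction with
  | algebraMap r => simp
  | gen i => simp [scaleHom, smul_smul, mul_comm (d' i), h i]
  | mul a b ha hb => simp [ha, hb]
  | add a b ha hb => simp [ha, hb]

/-- The automorphism rescaling each generator by a nonzero scalar. -/
def scale (q : ℂ) (d : Fin n → ℂ) (hd : ∀ i, d i ≠ 0) : QSpace q n ≃ₐ[ℂ] QSpace q n :=
  AlgEquiv.ofAlgHom (scaleHom q d) (scaleHom q fun i => (d i)⁻¹)
    (AlgHom.ext <| scaleHom_comp _ _ fun i => mul_inv_cancel₀ (hd i))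
    (AlgHom.ext <| scaleHom_comp _ _ fun i => inv_mul_cancel₀ (hd i))

@[simp]
lemma scale_Xg (d : Fin n → ℂ) (hd : ∀ i, d i ≠ 0) (i : Fin n) :
    scale q d hd (Xg q n i) = d i • Xg q n i := by
  simp [scale, scaleHom]

@[simp]
lemma scale_symm_Xg (d : Fin n → ℂ) (hd : ∀ i, d i ≠ 0) (i : Fin n) :
    (scale q d hd).symm (Xg q n i) = (d i)⁻¹ • Xg q n i := by
  simp [scale, scaleHom]

/-- A `(σ, τ)`-derivation with prescribed values on generators exists as soon as these values are
compatible with the defining relations. -/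
lemma exists_skewDerivation (σ τ : QSpace q n →ₐ[ℂ] QSpace q n) (v : Fin n → QSpace q n)
    (hv : ∀ i j, j < i → σ (Xg q n i) * v j + v i * τ (Xg q n j) =
      q • (σ (Xg q n j) * v i + v j * τ (Xg q n i))) :
    ∃ D : QSpace q n →ₗ[ℂ] QSpace q n,
      (∀ a b, D (a * b) = σ a * D b + D a * τ b) ∧ ∀ i, D (Xg q n i) = v i := by
  let M : QSpace q n →ₐ[ℂ] Matrix (Fin 2) (Fin 2) (QSpace q n) :=
    lift (fun i => !![σ (Xg q n i), v i; 0, τ (Xg q n i)]) fun i j h => by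
      have hσ := congrArg σ (Xg_mul_Xg (q := q) h)
      have hτ := congrArg τ (Xg_mul_Xg (q := q) h)
      simp only [map_mul, map_smul] at hσ hτ
      simp [Matrix.smul_of, hσ, hτ, hv i j h]
  have hM : ∀ a, M a 0 0 = σ a ∧ M a 1 0 = 0 ∧ M a 1 1 = τ a := by
    intro a
    induction a using induction with
    | algebraMap r => simp [Matrix.algebraMap_matrix_apply]
    | gen i => simp [M]
    | mul a b ha hb => simp [Matrix.mul_apply, Fin.sum_univ_two, ha, hb]
    | add a b ha hb => simp [ha, hb]
  refine ⟨Matrix.entryLinearMap ℂ (QSpace q n) 0 1 ∘ₗ M.toLinearMap, fun a b => ?_, fun i => ?_⟩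
  · simp [Matrix.mul_apply, Fin.sum_univ_two, hM]
  · simp [M]

end QSpace

section SkewDerivation

variable {A : Type} [Ring A] [Algebra ℂ A]

lemma skewDerivation_one {σ τ : A →ₐ[ℂ] A} {D : A →ₗ[ℂ] A}
    (hD : ∀ a b, D (a * b) = σ a * D b + D a * τ b) : D 1 = 0 := by
  simpa using hD 1 1

lemma skewDerivation_algebraMap {σ τ : A →ₐ[ℂ] A} {D : A →ₗ[ℂ] A}
    (hD : ∀ a b, D (a * b) = σ a * D b + D a * τ b) (r : ℂ) : D (algebraMap ℂ A r) = 0 := by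
  rw [Algebra.algebraMap_eq_smul_one, map_smul, skewDerivation_one hD, smul_zero]

end SkewDerivation

namespace QSpace

variable {q : ℂ} {n : ℕ}

/-- The relations of `U_q(sl(2))` hold on the quantum space as soon as they hold on generators. -/
lemma exists_uqslMA (k : QSpace q n ≃ₐ[ℂ] QSpace q n) (e f : QSpace q n →ₗ[ℂ] QSpace q n)
    (hq : q ≠ 0)
    (e_mul : ∀ a b, e (a * b) = a * e b + e a * k b)
    (f_mul : ∀ a b, f (a * b) = k.symm a * f b + f a * b)
    (ke : ∀ i, k (e (Xg q n i)) = (q ^ 2) • e (k (Xg q n i)))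
    (kf : ∀ i, f (k (Xg q n i)) = (q ^ 2) • k (f (Xg q n i)))
    (ef : ∀ i, e (f (Xg q n i)) - f (e (Xg q n i)) =
      (q - q⁻¹)⁻¹ • (k (Xg q n i) - k.symm (Xg q n i))) :
    ∃ π : UqslMA q 1 (QSpace q n), π.k 0 = k ∧ π.e 0 = e ∧ π.f 0 = f := by
  have e_scalar : ∀ r, e (algebraMap ℂ _ r) = 0 :=
    skewDerivation_algebraMap (σ := AlgHom.id ℂ _) (τ := k.toAlgHom) e_mul
  have f_scalar : ∀ r, f (algebraMap ℂ _ r) = 0 :=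
    skewDerivation_algebraMap (σ := k.symm.toAlgHom) (τ := AlgHom.id ℂ _) f_mul
  have hke : ∀ a, k (e a) = (q ^ 2) • e (k a) := by
    intro a
    induction a using induction with
    | algebraMap r => simp [e_scalar]
    | gen i => exact ke i
    | mul a b ha hb => simp [e_mul, ha, hb]
    | add a b ha hb => simp [ha, hb]
  have hkf : ∀ a, f (k a) = (q ^ 2) • k (f a) := by
    intro a
    induction a using induction with
    | algebraMap r => simp [f_scalar]
    | gen i => exact kf i
    | mul a b ha hb => simp [f_mul, ha, hb]
    | add a b ha hb => simp [ha, hb]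
  have hke' : ∀ a, e (k.symm a) = (q ^ 2) • k.symm (e a) := by
    intro a
    apply k.injective
    simp [hke]
  have hef : ∀ a, e (f a) - f (e a) = (q - q⁻¹)⁻¹ • (k a - k.symm a) := by
    intro a
    induction a using induction with
    | algebraMap r => simp [e_scalar, f_scalar]
    | gen i => exact ef i
    | mul a b ha hb =>
      have key : e (f (a * b)) - f (e (a * b)) =
          k.symm a * (e (f b) - f (e b)) + (e (f a) - f (e a)) * k b := by
        simp only [e_mul, f_mul, map_add, hke', hkf, smul_mul_assoc, mul_smul_comm,
          mul_sub, sub_mul]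
        abel
      rw [key, ha, hb, map_mul, map_mul, mul_smul_comm, smul_mul_assoc, ← smul_add]
      congr 1
      simp only [mul_sub, sub_mul]
      abel
    | add a b ha hb =>
      rw [map_add, map_add, map_add, map_add, add_sub_add_comm, ha, hb, ← smul_add, map_add,
        map_add, add_sub_add_comm]
  have hq2 : q ^ 2 ≠ 0 := pow_ne_zero 2 hq
  refine ⟨{
    k := fun _ => k
    e := fun _ => e
    f := fun _ => f
    e_mul := fun _ => e_mul
    f_mul := fun _ => f_mul
    e_one := fun _ => by simpa using e_scalar 1
    f_one := fun _ => by simpa using f_scalar 1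
    k_comm := fun _ _ _ => rfl
    ke := fun i j a => by
      rw [hke, AlgEquiv.apply_symm_apply, Subsingleton.elim i j]
      simp [cartan]
    kf := fun i j a => by
      have h := hkf (k.symm a)
      rw [AlgEquiv.apply_symm_apply] at h
      rw [h, smul_smul, Subsingleton.elim i j]
      simp only [cartan, if_true, zpow_neg]
      norm_cast
      rw [inv_mul_cancel₀ hq2, one_smul]
    ef := fun i j a => by rw [if_pos (Subsingleton.elim i j), hef]
    ee_comm := fun _ _ _ _ => rfl
    ff_comm := fun _ _ _ _ => rfl
    serre_e := fun i j h => by simp [cartan, Subsingleton.elim i j] at h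
    serre_f := fun i j h => by simp [cartan, Subsingleton.elim i j] at h }, rfl, rfl, rfl⟩

end QSpace

/-- The simplest `U_q(sl(2))`-module-algebra structure on `A_q(3)` of case `(∗₁₀)`. -/
theorem Uqsl2_on_Aq3_case10_exists (q : ℂ) (hq : q ≠ 0)
    (hq' : ∀ N : ℕ, 0 < N → q ^ N ≠ 1)
    (c₀ : ℂ) (hc₀ : c₀ ≠ 0) :
    ∃ π : UqslMA q 1 (QSpace q 3),
      π.k 0 (Z1 q) = q • Z1 q ∧ π.k 0 (Z2 q) = q • Z2 q ∧
      π.k 0 (Z3 q) = (q ^ (-2 : ℤ)) • Z3 q ∧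
      π.e 0 (Z1 q) = 0 ∧ π.e 0 (Z2 q) = 0 ∧ π.e 0 (Z3 q) = c₀ • 1 ∧
      π.f 0 (Z1 q) = c₀⁻¹ • (Z1 q * Z3 q) ∧
      π.f 0 (Z2 q) = c₀⁻¹ • (Z2 q * Z3 q) ∧
      π.f 0 (Z3 q) = (-q * c₀⁻¹) • (Z3 q ^ 2) := by
  have h10 : Xg q 3 1 * Xg q 3 0 = q • (Xg q 3 0 * Xg q 3 1) := QSpace.Xg_mul_Xg (by decide)
  have h20 : Xg q 3 2 * Xg q 3 0 = q • (Xg q 3 0 * Xg q 3 2) := QSpace.Xg_mul_Xg (by decide)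
  have h21 : Xg q 3 2 * Xg q 3 1 = q • (Xg q 3 1 * Xg q 3 2) := QSpace.Xg_mul_Xg (by decide)
  have h10' (a : QSpace q 3) :
      Xg q 3 1 * (Xg q 3 0 * a) = q • (Xg q 3 0 * (Xg q 3 1 * a)) := by
    rw [← mul_assoc, h10, smul_mul_assoc, mul_assoc]
  have h20' (a : QSpace q 3) :
      Xg q 3 2 * (Xg q 3 0 * a) = q • (Xg q 3 0 * (Xg q 3 2 * a)) := by
    rw [← mul_assoc, h20, smul_mul_assoc, mul_assoc]
  have h21' (a : QSpace q 3) :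
      Xg q 3 2 * (Xg q 3 1 * a) = q • (Xg q 3 1 * (Xg q 3 2 * a)) := by
    rw [← mul_assoc, h21, smul_mul_assoc, mul_assoc]
  have hq2 : q ^ 2 - 1 ≠ 0 := sub_ne_zero.2 (hq' 2 two_pos)
  have hd : ∀ i, (![q, q, q ^ (-2 : ℤ)] : Fin 3 → ℂ) i ≠ 0 := by
    intro i
    fin_cases i <;> simp [hq]
  let k := QSpace.scale q _ hd
  have k0 : k (Xg q 3 0) = q • Xg q 3 0 := by simp [k]
  have k1 : k (Xg q 3 1) = q • Xg q 3 1 := by simp [k]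
  have k2 : k (Xg q 3 2) = (q ^ (-2 : ℤ)) • Xg q 3 2 := by simp [k]
  have l0 : k.symm (Xg q 3 0) = q⁻¹ • Xg q 3 0 := by simp [k]
  have l1 : k.symm (Xg q 3 1) = q⁻¹ • Xg q 3 1 := by simp [k]
  have l2 : k.symm (Xg q 3 2) = (q ^ 2) • Xg q 3 2 := by simp [k]
  obtain ⟨e, e_mul, e_gen⟩ := QSpace.exists_skewDerivation (AlgHom.id ℂ _) k.toAlgHom
    ![0, 0, c₀ • 1] (by
      intro i j h
      fin_cases i <;> fin_cases j <;> first
        | exact absurd h (by decide)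
        | simp [k0, k1, k2, smul_comm q])
  obtain ⟨f, f_mul, f_gen⟩ := QSpace.exists_skewDerivation k.symm.toAlgHom (AlgHom.id ℂ _)
    ![c₀⁻¹ • (Xg q 3 0 * Xg q 3 2), c₀⁻¹ • (Xg q 3 1 * Xg q 3 2),
      (-q * c₀⁻¹) • (Xg q 3 2 ^ 2)] (by
      intro i j h
      fin_cases i <;> fin_cases j <;> first
        | exact absurd h (by decide)
        | simp [l0, l1, l2, pow_two, mul_assoc, h20, h21, h10', h20', h21', smul_smul]
      all_goals
        match_scalars
        field_simp
        try ring)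
  have e0 : e (Xg q 3 0) = 0 := e_gen 0
  have e1 : e (Xg q 3 1) = 0 := e_gen 1
  have e2 : e (Xg q 3 2) = c₀ • 1 := e_gen 2
  have f0 : f (Xg q 3 0) = c₀⁻¹ • (Xg q 3 0 * Xg q 3 2) := f_gen 0
  have f1 : f (Xg q 3 1) = c₀⁻¹ • (Xg q 3 1 * Xg q 3 2) := f_gen 1
  have f2 : f (Xg q 3 2) = (-q * c₀⁻¹) • (Xg q 3 2 ^ 2) := f_gen 2
  have f_one : f 1 = 0 := skewDerivation_one f_mul
  have e_mul : ∀ a b, e (a * b) = a * e b + e a * k b := e_mul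
  have f_mul : ∀ a b, f (a * b) = k.symm a * f b + f a * b := f_mul
  obtain ⟨π, hk, he, hf⟩ := QSpace.exists_uqslMA k e f hq e_mul f_mul
    (by
      intro i
      fin_cases i <;> simp [k0, k1, k2, e0, e1, e2]
      match_scalars
      field_simp)
    (by
      intro i
      fin_cases i <;> simp [k0, k1, k2, f0, f1, f2, smul_smul, pow_two]
      all_goals
        match_scalars
        field_simp)
    (by
      intro i
      fin_cases i <;> simp [k0, k1, k2, l0, l1, l2, e0, e1, e2, f0, f1, f2, f_one, e_mul,
        smul_smul, pow_two, hc₀]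
      all_goals
        match_scalars
        field_simp
        try ring)
  refine ⟨π, ?_⟩
  rw [hk, he, hf]
  exact ⟨k0, k1, k2, e0, e1, e2, f0, f1, f2⟩
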